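/- Let 𝔤 be the 3-dimensional real Lie algebra with basis {x,y,z} and Lie brackets [x,y] = 0, [x,z] = y, [y,z] = −x, and for ν > 0 equip 𝔤 with the inner product ⟨·,·⟩ making x, y, z pairwise orthogonal with ⟨x,x⟩ = ⟨y,y⟩ = 1 and ⟨z,z⟩ = ν. Then a vector W = a·x + b·y + c·z ∈ 𝔤 satisfies ⟨W,W⟩ = 1 and ⟨[W,u],v⟩ + ⟨u,[W,v]⟩ = 0 for all u,v ∈ 𝔤 if and only if a = b = 0 and c = ±1/√ν, i.e., W = ±(1/√ν)·z. -/

import Mathlib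

/-- **Unit Killing vectors on `Ẽ₀(2)`.** Let `𝔤` be the 3-dimensional real Lie algebra with
basis `{x, y, z}` and brackets `[x,y] = 0`, `[x,z] = y`, `[y,z] = -x`, endowed, for `ν > 0`,
with the inner product making `x, y, z` pairwise orthogonal with `⟨x,x⟩ = ⟨y,y⟩ = 1` and
`⟨z,z⟩ = ν`.  A vector `W = a•x + b•y + c•z` satisfies `⟨W,W⟩ = 1` and `ad W` is skew-adjoint
if and only if `a = b = 0` and `c = ±1/√ν`, i.e. `W = ±(1/√ν)•z`. -/
theorem unit_killing_vector_E02 (𝔤 : Type*) [LieRing 𝔤] [LieAlgebra ℝ 𝔤]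
    (x y z : 𝔤)
    (hindep : LinearIndependent ℝ ![x, y, z])
    (hspan : Submodule.span ℝ {x, y, z} = ⊤)
    (hxy : ⁅x, y⁆ = 0) (hxz : ⁅x, z⁆ = y) (hyz : ⁅y, z⁆ = -x)
    (ν : ℝ) (hν : 0 < ν)
    (ip : 𝔤 →ₗ[ℝ] 𝔤 →ₗ[ℝ] ℝ)
    (ip_symm : ∀ u v : 𝔤, ip u v = ip v u)
    (ip_pos : ∀ u : 𝔤, u ≠ 0 → 0 < ip u u)
    (ipxx : ip x x = 1) (ipyy : ip y y = 1) (ipzz : ip z z = ν)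
    (ipxy : ip x y = 0) (ipxz : ip x z = 0) (ipyz : ip y z = 0)
    (a b c : ℝ) (W : 𝔤) (hW : W = a • x + b • y + c • z) :
    (ip W W = 1 ∧ ∀ u v : 𝔤, ip ⁅W, u⁆ v + ip u ⁅W, v⁆ = 0) ↔
      (a = 0 ∧ b = 0 ∧ (c = 1 / Real.sqrt ν ∨ c = -(1 / Real.sqrt ν))) := by
  have hyx : ⁅y, x⁆ = 0 := by rw [← lie_skew, hxy, neg_zero]
  have hzx : ⁅z, x⁆ = -y := by rw [← lie_skew, hxz]
  have hzy : ⁅z, y⁆ = x := by rw [← lie_skew, hyz, neg_neg]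
  have ipyx : ip y x = 0 := by rw [ip_symm, ipxy]
  have ipzx : ip z x = 0 := by rw [ip_symm, ipxz]
  have ipzy : ip z y = 0 := by rw [ip_symm, ipyz]
  have norm_sq : ip W W = a ^ 2 + b ^ 2 + c ^ 2 * ν := by
    simp only [hW, map_add, map_smul, LinearMap.add_apply, LinearMap.smul_apply, smul_eq_mul,
      ipxx, ipyy, ipzz, ipxy, ipxz, ipyz, ipyx, ipzx, ipzy]
    ring
  have unit_iff : c ^ 2 * ν = 1 ↔ c = 1 / √ν ∨ c = -(1 / √ν) := by
    rw [← sq_eq_sq_iff_eq_or_eq_neg, div_pow, Real.sq_sqrt hν.le, one_pow, eq_div_iff hν.ne']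
  constructor
  · rintro ⟨hunit, hskew⟩
    have ha : a = 0 := by
      simpa [hW, hxy, hxz, hyz, hzy, ipxy, ipyy, ipzx] using hskew z y
    have hb : b = 0 := by
      simpa [hW, hyx, hxz, hyz, hzx, ipyx, ipxx, ipzy] using hskew z x
    refine ⟨ha, hb, unit_iff.mp ?_⟩
    simpa [norm_sq, ha, hb] using hunit
  · rintro ⟨rfl, rfl, hc⟩
    refine ⟨by simpa [norm_sq] using unit_iff.mpr hc, fun u v => ?_⟩
    have exists_coords (w : 𝔤) : ∃ p q r : ℝ, p • x + q • y + r • z = w := by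
      have hw : w ∈ Submodule.span ℝ {x, y, z} := hspan ▸ Submodule.mem_top
      obtain ⟨p, q, r, h⟩ := Submodule.mem_span_triple.mp hw
      exact ⟨p, q, r, h⟩
    obtain ⟨p, q, r, rfl⟩ := exists_coords u
    obtain ⟨p', q', r', rfl⟩ := exists_coords v
    simp only [hW, zero_smul, zero_add, smul_lie, lie_add, lie_smul, lie_self, hzx, hzy,
      map_add, map_smul, map_neg, map_zero, LinearMap.add_apply, LinearMap.smul_apply,
      LinearMap.neg_apply, LinearMap.zero_apply, smul_eq_mul,
      ipxx, ipyy, ipxy, ipxz, ipyz, ipyx, ipzx, ipzy]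
    ring
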